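/- Let β ∈ ℝ, 0 < α < 8/(d+n), E and m_c as above. Then the map c ↦ m_c is continuous on (0,∞). -/

import Mathlib

noncomputable section

open MeasureTheory Real Filter Set

namespace BNLS

/-- A point of `ℝ^d × 𝕋^n`, the torus being modelled by periodic functions on `ℝ^n`. -/
abbrev Pt (d n : ℕ) := (Fin d → ℝ) × (Fin n → ℝ)

/-- Fundamental domain `[0,2π)^n` of the torus `(ℝ/2πℤ)^n`. -/
def torusBox (n : ℕ) : Set (Fin n → ℝ) := Set.univ.pi fun _ => Set.Ico 0 (2*π)

/-- The measure of the torus `𝕋^n`. -/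
def μT (n : ℕ) : Measure (Fin n → ℝ) := volume.restrict (torusBox n)

/-- The measure of `ℝ^d × 𝕋^n`. -/
def μP (d n : ℕ) : Measure (Pt d n) := (volume : Measure (Fin d → ℝ)).prod (μT n)

/-- Partial derivative in the `i`-th `x`-direction. -/
def dX (d n : ℕ) (i : Fin d) (u : Pt d n → ℂ) : Pt d n → ℂ :=
  fun p => fderiv ℝ u p (Pi.single i 1, 0)

/-- Partial derivative in the `j`-th `y`-direction. -/
def dY (d n : ℕ) (j : Fin n) (u : Pt d n → ℂ) : Pt d n → ℂ :=
  fun p => fderiv ℝ u p (0, Pi.single j 1)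

/-- Partial Laplacian `Δ_x`. -/
def lapX (d n : ℕ) (u : Pt d n → ℂ) : Pt d n → ℂ := fun p => ∑ i, dX d n i (dX d n i u) p

/-- Partial Laplacian `Δ_y`. -/
def lapY (d n : ℕ) (u : Pt d n → ℂ) : Pt d n → ℂ := fun p => ∑ j, dY d n j (dY d n j u) p

/-- Full Laplacian `Δ_{x,y}`. -/
def lap (d n : ℕ) (u : Pt d n → ℂ) : Pt d n → ℂ := fun p => lapX d n u p + lapY d n u p

/-- Mass `‖u‖_{L²}²`. -/
def Mass (d n : ℕ) (u : Pt d n → ℂ) : ℝ := ∫ z, ‖u z‖^2 ∂(μP d n)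

/-- `‖u‖_{L^p}^p`. -/
def Npow (d n : ℕ) (p : ℝ) (u : Pt d n → ℂ) : ℝ := ∫ z, ‖u z‖ ^ p ∂(μP d n)

/-- The `L^p` norm. -/
def LpN (d n : ℕ) (p : ℝ) (u : Pt d n → ℂ) : ℝ := (Npow d n p u) ^ (1/p)

/-- `‖Δ u‖_{L²}²`. -/
def lapSq (d n : ℕ) (u : Pt d n → ℂ) : ℝ := ∫ z, ‖lap d n u z‖^2 ∂(μP d n)

/-- `‖Δ_x u‖_{L²}²`. -/
def lapXSq (d n : ℕ) (u : Pt d n → ℂ) : ℝ := ∫ z, ‖lapX d n u z‖^2 ∂(μP d n)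

/-- `‖Δ_y u‖_{L²}²`. -/
def lapYSq (d n : ℕ) (u : Pt d n → ℂ) : ℝ := ∫ z, ‖lapY d n u z‖^2 ∂(μP d n)

/-- `‖∇_x u‖_{L²}²`. -/
def gradXSq (d n : ℕ) (u : Pt d n → ℂ) : ℝ := ∫ z, (∑ i, ‖dX d n i u z‖^2) ∂(μP d n)

/-- `‖∇_y u‖_{L²}²`. -/
def gradYSq (d n : ℕ) (u : Pt d n → ℂ) : ℝ := ∫ z, (∑ j, ‖dY d n j u z‖^2) ∂(μP d n)

/-- `‖∇ u‖_{L²}²`. -/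
def gradSq (d n : ℕ) (u : Pt d n → ℂ) : ℝ := gradXSq d n u + gradYSq d n u

/-- Pointwise sum of squares of all second derivatives. -/
def hessInt (d n : ℕ) (u : Pt d n → ℂ) (z : Pt d n) : ℝ :=
  (∑ i, ∑ i', ‖dX d n i (dX d n i' u) z‖^2) + (∑ i, ∑ j, ‖dY d n j (dX d n i u) z‖^2)
  + (∑ j, ∑ i, ‖dX d n i (dY d n j u) z‖^2) + (∑ j, ∑ j', ‖dY d n j (dY d n j' u) z‖^2)

/-- `‖∇² u‖_{L²}²`. -/
def hessSq (d n : ℕ) (u : Pt d n → ℂ) : ℝ := ∫ z, hessInt d n u z ∂(μP d n)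

/-- The `H²` norm on `ℝ^d × 𝕋^n`. -/
def H2norm (d n : ℕ) (u : Pt d n → ℂ) : ℝ :=
  Real.sqrt (Mass d n u + gradSq d n u + hessSq d n u)

/-- `2π`-periodicity in all `y`-variables. -/
def Periodic (d n : ℕ) (u : Pt d n → ℂ) : Prop :=
  ∀ j : Fin n, ∀ p : Pt d n, u (p.1, p.2 + (2*π) • (Pi.single j 1 : Fin n → ℝ)) = u p

/-- Membership in `H²(ℝ^d × 𝕋^n)`. -/
def InH2 (d n : ℕ) (u : Pt d n → ℂ) : Prop :=
  ContDiff ℝ 2 u ∧ Periodic d n u ∧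
  Integrable (fun z => ‖u z‖^2) (μP d n) ∧
  Integrable (fun z => (∑ i, ‖dX d n i u z‖^2) + ∑ j, ‖dY d n j u z‖^2) (μP d n) ∧
  Integrable (hessInt d n u) (μP d n)

/-- The mass sphere `S(c)`. -/
def Sset (d n : ℕ) (c : ℝ) : Set (Pt d n → ℂ) := {u | InH2 d n u ∧ Mass d n u = c}

/-- The energy functional `E`. -/
def En (d n : ℕ) (β α : ℝ) (u : Pt d n → ℂ) : ℝ :=
  (1/2) * lapSq d n u + (β/2) * gradSq d n u - (1/(α+2)) * Npow d n (α+2) u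

/-- The ground state energy `m_c`. -/
def mC (d n : ℕ) (β α c : ℝ) : ℝ := sInf (En d n β α '' Sset d n c)

end BNLS


namespace BNLS
open MeasureTheory Real Filter Set


/-- coordinate directions -/
def ev (d n : ℕ) : Fin d ⊕ Fin n → Pt d n
  | .inl i => (Pi.single i 1, 0)
  | .inr j => (0, Pi.single j 1)

lemma torusBox_ae (n : ℕ) : (volume.restrict (torusBox n) : Measure (Fin n → ℝ)) =
    volume.restrict (Icc (0 : Fin n → ℝ) (fun _ => 2*π)) := by
  apply Measure.restrict_congr_set
  have := Measure.univ_pi_Ico_ae_eq_Icc (μ := fun _ : Fin n => (volume : Measure ℝ))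
    (f := (0 : Fin n → ℝ)) (g := fun _ => 2*π)
  exact this

instance (n : ℕ) : SFinite (μT n) := by unfold μT; infer_instance
instance (n : ℕ) : SigmaFinite (μT n) := by unfold μT; infer_instance
instance (d n : ℕ) : SigmaFinite (μP d n) := by unfold μP; infer_instance

lemma torus_ibp (n : ℕ) (j : Fin n) (F : (Fin n → ℝ) → ℝ) (hF : Differentiable ℝ F)
    (hper : ∀ y, F (y + (2*π) • (Pi.single j 1 : Fin n → ℝ)) = F y)
    (hi : Integrable (fun y => fderiv ℝ F y (Pi.single j 1)) (μT n)) :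
    ∫ y, fderiv ℝ F y (Pi.single j 1) ∂(μT n) = 0 := by
  unfold μT at *
  rw [torusBox_ae] at *
  obtain ⟨m, rfl⟩ : ∃ m, n = m + 1 := ⟨n - 1, by have := j.pos; omega⟩
  have h := integral_divergence_of_hasFDerivAt_off_countable' (0 : Fin (m+1) → ℝ)
    (fun _ => 2*π) (by intro i; simp; positivity)
    (fun i => if i = j then F else 0) (fun i => if i = j then fderiv ℝ F else 0) ∅
    countable_empty ?_ ?_ ?_
  · rw [Finset.sum_eq_single j] at h
    · simp only [if_true] at h
      have e : ∀ x : Fin (m+1) → ℝ, (∑ i, (if i = j then fderiv ℝ F else 0 :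
        (Fin (m+1) → ℝ) → (Fin (m+1) → ℝ) →L[ℝ] ℝ) x (Pi.single i 1)) =
         fderiv ℝ F x (Pi.single j 1) := by
        intro x
        rw [Finset.sum_eq_single j]
        · simp
        · intro b _ hb; simp [hb]
        · simp
      simp only [e] at h
      rw [h, sub_eq_zero]
      congr 1; ext x
      rw [← hper (j.insertNth ((0 : Fin (m+1) → ℝ) j) x)]
      congr 1
      ext k
      refine j.succAboveCases ?_ ?_ k
      · simp
      · intro k; simp
    · intro b _ hb; simp [hb]
    · simp
  · intro i; by_cases h : i = j
    · simp [h, hF.continuous.continuousOn]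
    · simp only [h, if_false]; exact continuousOn_const
  · intro x _ i
    by_cases h : i = j
    · simp [h, (hF x).hasFDerivAt]
    · simp [h, hasFDerivAt_zero]
  · have e : ∀ x : Fin (m+1) → ℝ, (∑ i, (if i = j then fderiv ℝ F else 0 :
        (Fin (m+1) → ℝ) → (Fin (m+1) → ℝ) →L[ℝ] ℝ) x (Pi.single i 1)) =
         fderiv ℝ F x (Pi.single j 1) := by
        intro x
        rw [Finset.sum_eq_single j]
        · simp
        · intro b _ hb; simp [hb]
        · simp
    simp only [e]
    exact hi

lemma ibp (d n : ℕ) (k : Fin d ⊕ Fin n) (F : Pt d n → ℝ) (hF : Differentiable ℝ F)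
    (hper : ∀ j : Fin n, ∀ p : Pt d n, F (p.1, p.2 + (2*π) • (Pi.single j 1 : Fin n → ℝ)) = F p)
    (h0 : Integrable F (μP d n))
    (hi : Integrable (fun z => fderiv ℝ F z (ev d n k)) (μP d n)) :
    ∫ z, fderiv ℝ F z (ev d n k) ∂(μP d n) = 0 := by
  unfold μP at *
  cases k with
  | inl i =>
    rw [integral_prod_symm _ hi]
    apply integral_eq_zero_of_ae
    filter_upwards [hi.prod_left_ae, h0.prod_left_ae] with y h1 h2
    have hd : ∀ x, HasFDerivAt (fun x => F (x, y))
        ((fderiv ℝ F (x, y)).comp (ContinuousLinearMap.inl ℝ _ _)) x := by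
      intro x
      exact (hF (x, y)).hasFDerivAt.comp x (hasFDerivAt_prodMk_left x y)
    have he : ∀ x, fderiv ℝ F (x, y) (ev d n (.inl i)) =
        fderiv ℝ (fun x => F (x, y)) x (Pi.single i 1) := by
      intro x; rw [(hd x).fderiv]; simp [ev]
    simp only [he] at h1 ⊢
    have := integral_mul_fderiv_eq_neg_fderiv_mul_of_integrable (μ := (volume : Measure (Fin d → ℝ)))
      (f := fun _ => (1:ℝ)) (g := fun x => F (x, y)) (v := Pi.single i 1)
      (by simp) (by simpa using h1) (by simpa using h2) (by simp)
      (fun x _ => (hd x).differentiableAt)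
    simpa using this
  | inr j =>
    rw [integral_prod _ hi]
    apply integral_eq_zero_of_ae
    filter_upwards [hi.prod_right_ae] with x h1
    have hd : ∀ y, HasFDerivAt (fun y => F (x, y))
        ((fderiv ℝ F (x, y)).comp (ContinuousLinearMap.inr ℝ _ _)) y := by
      intro y
      exact (hF (x, y)).hasFDerivAt.comp y (hasFDerivAt_prodMk_right x y)
    have he : ∀ y, fderiv ℝ F (x, y) (ev d n (.inr j)) =
        fderiv ℝ (fun y => F (x, y)) y (Pi.single j 1) := by
      intro y; rw [(hd y).fderiv]; simp [ev]
    simp only [he] at h1 ⊢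
    exact torus_ibp n j _ (fun y => (hd y).differentiableAt) (fun y => hper j (x, y)) h1

end BNLS

namespace BNLS
open MeasureTheory Real Filter Set
open scoped ENNReal


lemma line_bound (I : Set ℝ) (hI : MeasurableSet I) (φ : ℝ → ℝ) (hφ : ContDiff ℝ 1 φ) (a t : ℝ)
    (ha : Icc a (a+1) ⊆ I) (ht : t ∈ Icc a (a+1)) :
    ‖φ t‖ₑ ≤ ∫⁻ s in I, (‖φ s‖ₑ + ‖deriv φ s‖ₑ) := by
  have hd : Differentiable ℝ φ := hφ.differentiable (by simp)
  have hc : Continuous (deriv φ) := hφ.continuous_deriv (by simp)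
  have h1 : ∀ s ∈ Icc a (a+1), ‖φ t‖ₑ ≤ ‖φ s‖ₑ + ∫⁻ r in Icc a (a+1), ‖deriv φ r‖ₑ := by
    intro s hs
    have e : φ t = φ s + ∫ r in s..t, deriv φ r := by
      rw [intervalIntegral.integral_deriv_eq_sub (fun x _ => hd x) (hc.intervalIntegrable _ _)]
      ring
    rw [e]
    refine (enorm_add_le _ _).trans ?_
    gcongr
    have : ‖∫ r in s..t, deriv φ r‖ₑ = ‖∫ r in uIoc s t, deriv φ r‖ₑ := by
      rw [← ofReal_norm, ← ofReal_norm, intervalIntegral.norm_intervalIntegral_eq]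
    rw [this]
    refine (enorm_integral_le_lintegral_enorm _).trans ?_
    apply lintegral_mono_set
    intro r hr
    have hr' : min s t < r ∧ r ≤ max s t := hr
    constructor
    · exact (le_min hs.1 ht.1).trans hr'.1.le
    · exact hr'.2.trans (max_le hs.2 ht.2)
  calc ‖φ t‖ₑ = ∫⁻ s in Icc a (a+1), ‖φ t‖ₑ := by simp
    _ ≤ ∫⁻ s in Icc a (a+1), (‖φ s‖ₑ + ∫⁻ r in Icc a (a+1), ‖deriv φ r‖ₑ) :=
        setLIntegral_mono' measurableSet_Icc h1
    _ = ∫⁻ s in Icc a (a+1), (‖φ s‖ₑ + ‖deriv φ s‖ₑ) := by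
        rw [lintegral_add_right _ measurable_const, lintegral_add_right _ hc.enorm.measurable]
        simp
    _ ≤ _ := lintegral_mono_set ha

/-- coordinate measures -/
def μc (d n : ℕ) : Fin d ⊕ Fin n → Measure ℝ
  | .inl _ => volume
  | .inr _ => volume.restrict (Ico 0 (2*π))

instance (d n : ℕ) (k) : SigmaFinite (μc d n k) := by
  cases k <;> (unfold μc; infer_instance)

lemma mp (d n : ℕ) : MeasurePreserving (MeasurableEquiv.sumPiEquivProdPi (fun _ : Fin d ⊕ Fin n => ℝ))
    (Measure.pi (μc d n)) (μP d n) := by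
  have h := measurePreserving_sumPiEquivProdPi (X := fun _ : Fin d ⊕ Fin n => ℝ) (μc d n)
  have e : (Measure.pi fun i => μc d n (.inl i)).prod (Measure.pi fun i => μc d n (.inr i)) = μP d n := by
    unfold μP μT torusBox μc
    rw [volume_pi, volume_pi, Measure.restrict_pi_pi]
  rw [e] at h
  exact h

lemma upd (d n : ℕ) (x : Fin d ⊕ Fin n → ℝ) (k : Fin d ⊕ Fin n) (t : ℝ) :
    MeasurableEquiv.sumPiEquivProdPi (fun _ : Fin d ⊕ Fin n => ℝ) (Function.update x k t) =
      MeasurableEquiv.sumPiEquivProdPi (fun _ : Fin d ⊕ Fin n => ℝ) x + (t - x k) • ev d n k := by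
  cases k with
  | inl i =>
    ext l
    · by_cases h : l = i
      · subst h; simp [MeasurableEquiv.sumPiEquivProdPi, ev]
      · simp [MeasurableEquiv.sumPiEquivProdPi, ev, h]
    · simp [MeasurableEquiv.sumPiEquivProdPi, ev]
  | inr i =>
    ext l
    · simp [MeasurableEquiv.sumPiEquivProdPi, ev]
    · by_cases h : l = i
      · subst h; simp [MeasurableEquiv.sumPiEquivProdPi, ev]
      · simp [MeasurableEquiv.sumPiEquivProdPi, ev, h]

lemma sobolev (d n : ℕ) (hd : 1 ≤ d) (hn : 1 ≤ n) (g : Pt d n → ℝ) (hg : ContDiff ℝ 1 g) :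
    ∫⁻ z, ‖g z‖ₑ ^ (((d:ℝ)+n)/((d:ℝ)+n-1)) ∂(μP d n) ≤
      (∫⁻ z, (‖g z‖ₑ + ∑ k, ‖fderiv ℝ g z (ev d n k)‖ₑ) ∂(μP d n)) ^ (((d:ℝ)+n)/((d:ℝ)+n-1)) := by
  have hd' : (1:ℝ) ≤ d := by exact_mod_cast hd
  have hn' : (1:ℝ) ≤ n := by exact_mod_cast hn
  set f : Pt d n → ℝ≥0∞ := fun z => ‖g z‖ₑ + ∑ k, ‖fderiv ℝ g z (ev d n k)‖ₑ with hf
  have hgd : Differentiable ℝ g := hg.differentiable (by simp)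
  have hgc : Continuous g := hgd.continuous
  have hfm : Measurable f := by
    have := hg.continuous_fderiv (by simp)
    apply Measurable.add hgc.enorm.measurable
    apply Finset.measurable_sum
    intro k _
    exact (this.clm_apply continuous_const).enorm.measurable
  set Φ := MeasurableEquiv.sumPiEquivProdPi (fun _ : Fin d ⊕ Fin n => ℝ)
  rw [← (mp d n).lintegral_comp_emb Φ.measurableEmbedding,
    ← (mp d n).lintegral_comp_emb Φ.measurableEmbedding]
  have hcard : ((Fintype.card (Fin d ⊕ Fin n) : ℕ) : ℝ) = (d:ℝ)+n := by simp
  have hp : Real.HolderConjugate (Fintype.card (Fin d ⊕ Fin n) : ℝ) (((d:ℝ)+n)/((d:ℝ)+n-1)) := by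
    rw [hcard]
    exact (Real.holderConjugate_iff_eq_conjExponent (by linarith)).2 rfl
  refine le_trans ?_ (lintegral_prod_lintegral_pow_le (μc d n) hp (hfm.comp Φ.measurable))
  apply lintegral_mono_ae
  have hbox : ∀ᵐ x ∂(Measure.pi (μc d n)), ∀ j : Fin n, x (.inr j) ∈ Ico 0 (2*π) := by
    rw [ae_all_iff]
    intro j
    have : ∀ᵐ t ∂(μc d n (.inr j)), t ∈ Ico 0 (2*π) := ae_restrict_mem measurableSet_Ico
    exact (Measure.quasiMeasurePreserving_eval (μc d n) (.inr j)).ae this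
  filter_upwards [hbox] with x hx
  have key : ∀ k, ‖g (Φ x)‖ₑ ≤ ∫⁻ t, (f ∘ Φ) (Function.update x k t) ∂(μc d n k) := by
    intro k
    set φ : ℝ → ℝ := fun t => g (Φ x + (t - x k) • ev d n k) with hφ
    have hφc : ContDiff ℝ 1 φ := by
      apply hg.comp
      fun_prop
    have hφd : ∀ t, deriv φ t = fderiv ℝ g (Φ x + (t - x k) • ev d n k) (ev d n k) := by
      intro t
      apply HasDerivAt.deriv
      have h1 : HasDerivAt (fun t : ℝ => Φ x + (t - x k) • ev d n k) (ev d n k) t := by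
        simpa using (((hasDerivAt_id t).sub_const (x k)).smul_const (ev d n k)).const_add (Φ x)
      exact (hgd _).hasFDerivAt.comp_hasDerivAt t h1
    have h0 : φ (x k) = g (Φ x) := by simp [hφ]
    have hle : ∀ t, ‖φ t‖ₑ + ‖deriv φ t‖ₑ ≤ (f ∘ Φ) (Function.update x k t) := by
      intro t
      simp only [Function.comp, hf]
      rw [upd, hφd]
      apply add_le_add le_rfl
      exact Finset.single_le_sum (f := fun k' => ‖fderiv ℝ g (Φ x + (t - x k) • ev d n k) (ev d n k')‖ₑ)
        (fun _ _ => by positivity) (Finset.mem_univ k)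
    rw [← h0]
    refine le_trans ?_ (lintegral_mono hle)
    cases k with
    | inl i =>
      have := line_bound univ MeasurableSet.univ φ hφc (x (.inl i)) (x (.inl i)) (subset_univ _)
        (by simp)
      simpa [μc] using this
    | inr j =>
      have hpi := Real.pi_gt_three
      obtain ⟨h1, h2⟩ := hx j
      refine line_bound (Ico 0 (2*π)) measurableSet_Ico φ hφc
        (if x (.inr j) ≤ 3 then x (.inr j) else x (.inr j) - 1) (x (.inr j)) ?_ ?_
      · split_ifs with h
        · intro s hs; exact ⟨h1.trans hs.1, by linarith [hs.2]⟩
        · intro s hs; push Not at h; exact ⟨by linarith [hs.1], by linarith [hs.2]⟩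
      · split_ifs <;> constructor <;> linarith
  rw [hcard]
  have hpos : 0 < (d:ℝ)+n-1 := by linarith
  calc ‖g (Φ x)‖ₑ ^ (((d:ℝ)+n)/((d:ℝ)+n-1))
      = ∏ k : Fin d ⊕ Fin n, ‖g (Φ x)‖ₑ ^ ((1:ℝ)/((d:ℝ)+n-1)) := by
        rw [Finset.prod_const, Finset.card_univ, ← ENNReal.rpow_natCast, ← ENNReal.rpow_mul, hcard]
        congr 1; field_simp
    _ ≤ _ := by
        apply Finset.prod_le_prod'
        intro k _
        exact ENNReal.rpow_le_rpow (key k) (by positivity)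

end BNLS

namespace BNLS
open MeasureTheory Real Filter Set
open scoped ENNReal RealInnerProductSpace


/-- first derivative along the k-th coordinate -/
def v1 {d n : ℕ} (u : Pt d n → ℂ) (k : Fin d ⊕ Fin n) : Pt d n → ℂ := fun z => fderiv ℝ u z (ev d n k)
/-- pure second derivative along the k-th coordinate -/
def v2 {d n : ℕ} (u : Pt d n → ℂ) (k : Fin d ⊕ Fin n) : Pt d n → ℂ := v1 (v1 u k) k

/-- squared gradient -/
def gd {d n : ℕ} (u : Pt d n → ℂ) (z : Pt d n) : ℝ := ∑ k, ‖v1 u k z‖^2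

lemma lap_eq {d n : ℕ} (u : Pt d n → ℂ) (z : Pt d n) : lap d n u z = ∑ k, v2 u k z := by
  rw [Fintype.sum_sum_type]; rfl

lemma gd_eq {d n : ℕ} (u : Pt d n → ℂ) (z : Pt d n) :
    gd u z = (∑ i, ‖dX d n i u z‖^2) + ∑ j, ‖dY d n j u z‖^2 := by
  unfold gd
  rw [Fintype.sum_sum_type]; rfl

lemma v1_contDiff {d n : ℕ} {u : Pt d n → ℂ} (h : ContDiff ℝ 2 u) (k) : ContDiff ℝ 1 (v1 u k) := by
  have : ContDiff ℝ 1 (fderiv ℝ u) := h.fderiv_right (by norm_num)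
  exact this.clm_apply contDiff_const

lemma v2_continuous {d n : ℕ} {u : Pt d n → ℂ} (h : ContDiff ℝ 2 u) (k) : Continuous (v2 u k) :=
  ((v1_contDiff h k).continuous_fderiv (by simp)).clm_apply continuous_const

lemma lap_continuous {d n : ℕ} {u : Pt d n → ℂ} (h : ContDiff ℝ 2 u) : Continuous (lap d n u) := by
  have : lap d n u = fun z => ∑ k, v2 u k z := by ext z; exact lap_eq u z
  rw [this]
  exact continuous_finsetSum _ fun k _ => v2_continuous h k

lemma gd_int {d n : ℕ} {u : Pt d n → ℂ} (h : InH2 d n u) : Integrable (gd u) (μP d n) := by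
  have : gd u = fun z => (∑ i, ‖dX d n i u z‖^2) + ∑ j, ‖dY d n j u z‖^2 := by ext z; exact gd_eq u z
  rw [this]; exact h.2.2.2.1

lemma v1_int {d n : ℕ} {u : Pt d n → ℂ} (h : InH2 d n u) (k) :
    Integrable (fun z => ‖v1 u k z‖^2) (μP d n) := by
  refine (gd_int h).mono' ((v1_contDiff h.1 k).continuous.norm.pow 2).aestronglyMeasurable ?_
  refine Eventually.of_forall fun z => ?_
  rw [Real.norm_of_nonneg (by positivity)]
  exact Finset.single_le_sum (f := fun k => ‖v1 u k z‖^2) (fun _ _ => by positivity) (Finset.mem_univ k)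

lemma v2_le {d n : ℕ} (u : Pt d n → ℂ) (k) (z : Pt d n) : ‖v2 u k z‖^2 ≤ hessInt d n u z := by
  unfold hessInt
  have e1 : 0 ≤ ∑ i, ∑ i', ‖dX d n i (dX d n i' u) z‖^2 := by positivity
  have e2 : 0 ≤ (∑ i, ∑ j, ‖dY d n j (dX d n i u) z‖^2) := by positivity
  have e3 : 0 ≤ (∑ j, ∑ i, ‖dX d n i (dY d n j u) z‖^2) := by positivity
  have e4 : 0 ≤ (∑ j, ∑ j', ‖dY d n j (dY d n j' u) z‖^2) := by positivity
  cases k with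
  | inl i =>
    have h1 : ‖v2 u (.inl i) z‖^2 ≤ ∑ i', ‖dX d n i (dX d n i' u) z‖^2 :=
      Finset.single_le_sum (f := fun i' => ‖dX d n i (dX d n i' u) z‖^2) (fun _ _ => by positivity)
        (Finset.mem_univ i)
    have h2 := Finset.single_le_sum (f := fun i => ∑ i', ‖dX d n i (dX d n i' u) z‖^2)
      (fun _ _ => by positivity) (Finset.mem_univ i)
    linarith
  | inr i =>
    have h1 : ‖v2 u (.inr i) z‖^2 ≤ ∑ i', ‖dY d n i (dY d n i' u) z‖^2 :=
      Finset.single_le_sum (f := fun i' => ‖dY d n i (dY d n i' u) z‖^2) (fun _ _ => by positivity)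
        (Finset.mem_univ i)
    have h2 := Finset.single_le_sum (f := fun i => ∑ i', ‖dY d n i (dY d n i' u) z‖^2)
      (fun _ _ => by positivity) (Finset.mem_univ i)
    linarith

lemma v2_int {d n : ℕ} {u : Pt d n → ℂ} (h : InH2 d n u) (k) :
    Integrable (fun z => ‖v2 u k z‖^2) (μP d n) := by
  refine h.2.2.2.2.mono' ((v2_continuous h.1 k).norm.pow 2).aestronglyMeasurable ?_
  refine Eventually.of_forall fun z => ?_
  rw [Real.norm_of_nonneg (by positivity)]
  exact v2_le u k z

lemma lap_int {d n : ℕ} {u : Pt d n → ℂ} (h : InH2 d n u) :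
    Integrable (fun z => ‖lap d n u z‖^2) (μP d n) := by
  have hs : Integrable (fun z => (Fintype.card (Fin d ⊕ Fin n) : ℝ) * ∑ k, ‖v2 u k z‖^2) (μP d n) :=
    (integrable_finsetSum _ fun k _ => v2_int h k).const_mul _
  refine hs.mono' ((lap_continuous h.1).norm.pow 2).aestronglyMeasurable ?_
  refine Eventually.of_forall fun z => ?_
  rw [Real.norm_of_nonneg (by positivity), lap_eq]
  calc ‖∑ k, v2 u k z‖^2 ≤ (∑ k, ‖v2 u k z‖)^2 := by gcongr; exact norm_sum_le _ _
    _ ≤ _ := by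
      have := sq_sum_le_card_mul_sum_sq (s := Finset.univ) (f := fun k => ‖v2 u k z‖)
      simpa using this

lemma v1_per {d n : ℕ} {u : Pt d n → ℂ} (h : Periodic d n u) (k) : Periodic d n (v1 u k) := by
  intro j p
  unfold v1
  have : u = fun q => u (q + ((0 : Fin d → ℝ), (2*π) • (Pi.single j 1 : Fin n → ℝ))) := by
    ext q
    rw [← h j q]
    congr 1
    ext <;> simp
  conv_rhs => rw [this]
  rw [fderiv_comp_add_right]
  congr 2
  ext <;> simp

lemma weighted {d n : ℕ} {u : Pt d n → ℂ} (h : InH2 d n u) (ψ ψ' : ℝ → ℝ) (B : ℝ)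
    (h1 : ∀ t, 0 ≤ t → HasDerivAt ψ (ψ' t) t) (h2 : ∀ t, 0 ≤ t → 0 ≤ ψ' t)
    (h3 : ∀ t, 0 ≤ t → 0 ≤ ψ t) (h4 : ∀ t, 0 ≤ t → ψ t ≤ B) (h5 : ∀ t, 0 ≤ t → t * ψ' t ≤ B) :
    Integrable (fun z => ψ (‖u z‖^2) * gd u z) (μP d n) ∧
    Integrable (fun z => ψ (‖u z‖^2) * (‖u z‖ * ‖lap d n u z‖)) (μP d n) ∧
    ∫ z, ψ (‖u z‖^2) * gd u z ∂(μP d n) ≤ ∫ z, ψ (‖u z‖^2) * (‖u z‖ * ‖lap d n u z‖) ∂(μP d n) := by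
  have hB : 0 ≤ B := (h3 0 le_rfl).trans (h4 0 le_rfl)
  have huc := h.1.continuous
  have hud : Differentiable ℝ u := h.1.differentiable (by norm_num)
  have hψc : Continuous fun z => ψ (‖u z‖^2) := by
    rw [continuous_iff_continuousAt]
    intro z
    exact ContinuousAt.comp (g := ψ) (h1 _ (by positivity)).continuousAt (huc.norm.pow 2).continuousAt
  have hM := h.2.2.1
  have prod_int : ∀ (a b : Pt d n → ℂ), Continuous a → Continuous b →
      Integrable (fun z => ‖a z‖^2) (μP d n) → Integrable (fun z => ‖b z‖^2) (μP d n) →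
      Integrable (fun z => ‖a z‖ * ‖b z‖) (μP d n) := by
    intro a b ha hb hia hib
    refine (hia.add hib).mono' (ha.norm.mul hb.norm).aestronglyMeasurable
      (Eventually.of_forall fun z => ?_)
    rw [Real.norm_of_nonneg (by positivity)]
    simp only [Pi.add_apply]
    nlinarith [sq_nonneg (‖a z‖ - ‖b z‖), sq_nonneg (‖a z‖ + ‖b z‖)]
  have bdd_int : ∀ (a : Pt d n → ℝ), Integrable a (μP d n) →
      Integrable (fun z => ψ (‖u z‖^2) * a z) (μP d n) := by
    intro a ha
    refine ha.bdd_mul (c := B) hψc.aestronglyMeasurable (Eventually.of_forall fun z => ?_)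
    rw [Real.norm_of_nonneg (h3 _ (by positivity))]
    exact h4 _ (by positivity)
  have I1 := bdd_int _ (gd_int h)
  have I2 := bdd_int _ (prod_int u (lap d n u) huc (lap_continuous h.1) hM (lap_int h))
  refine ⟨I1, I2, ?_⟩
  set F : (Fin d ⊕ Fin n) → Pt d n → ℝ := fun k z => ψ (‖u z‖^2) * ⟪u z, v1 u k z⟫ with hF
  have hderiv : ∀ k z, HasFDerivAt (F k) (fderiv ℝ (F k) z) z ∧ fderiv ℝ (F k) z (ev d n k) =
      ψ' (‖u z‖^2) * 2 * ⟪u z, v1 u k z⟫^2 + ψ (‖u z‖^2) * (‖v1 u k z‖^2 + ⟪u z, v2 u k z⟫) := by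
    intro k z
    have a1 := (hud z).hasFDerivAt
    have a2 := (((v1_contDiff h.1 k).differentiable (by simp)) z).hasFDerivAt
    have a3 := a1.norm_sq
    have a4 := (h1 (‖u z‖^2) (by positivity)).comp_hasFDerivAt z a3
    have a5 := a4.mul (a1.inner ℝ a2)
    have a6 : HasFDerivAt (F k) _ z := a5
    refine ⟨a6.differentiableAt.hasFDerivAt, ?_⟩
    rw [a6.fderiv]
    have e1 : fderiv ℝ u z (ev d n k) = v1 u k z := rfl
    have e2 : fderiv ℝ (v1 u k) z (ev d n k) = v2 u k z := rfl
    simp [e1, e2, fderivInnerCLM_apply]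
    ring
  have hFd : ∀ k, Differentiable ℝ (F k) := fun k z => (hderiv k z).1.differentiableAt
  have hFint : ∀ k, Integrable (F k) (μP d n) := by
    intro k
    apply bdd_int
    refine (prod_int u (v1 u k) huc (v1_contDiff h.1 k).continuous hM (v1_int h k)).mono'
      (huc.inner (v1_contDiff h.1 k).continuous).aestronglyMeasurable
      (Eventually.of_forall fun z => norm_inner_le_norm _ _)
  have I3 : ∀ k, Integrable (fun z => ψ (‖u z‖^2) * ⟪u z, v2 u k z⟫) (μP d n) := by
    intro k
    apply bdd_int
    refine (prod_int u (v2 u k) huc (v2_continuous h.1 k) hM (v2_int h k)).mono'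
      (huc.inner (v2_continuous h.1 k)).aestronglyMeasurable
      (Eventually.of_forall fun z => norm_inner_le_norm _ _)
  have hF'int : ∀ k, Integrable (fun z => fderiv ℝ (F k) z (ev d n k)) (μP d n) := by
    intro k
    have m : AEStronglyMeasurable (fun z => fderiv ℝ (F k) z (ev d n k)) (μP d n) :=
      (measurable_fderiv_apply_const ℝ (F k) (ev d n k)).aestronglyMeasurable
    refine (((v1_int h k).const_mul (3*B)).add (I3 k).norm).mono' m (Eventually.of_forall fun z => ?_)
    rw [(hderiv k z).2]
    have t0 : 0 ≤ ‖u z‖^2 := by positivity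
    have c1 : ⟪u z, v1 u k z⟫^2 ≤ ‖u z‖^2 * ‖v1 u k z‖^2 := by
      rw [← mul_pow, ← sq_abs]
      gcongr
      exact abs_real_inner_le_norm _ _
    have c2 : |ψ' (‖u z‖^2) * 2 * ⟪u z, v1 u k z⟫^2| ≤ 2 * B * ‖v1 u k z‖^2 := by
      rw [abs_of_nonneg (by have := h2 _ t0; positivity)]
      calc _ ≤ ψ' (‖u z‖^2) * 2 * (‖u z‖^2 * ‖v1 u k z‖^2) := by
            have := h2 _ t0; gcongr
        _ = 2 * (‖u z‖^2 * ψ' (‖u z‖^2)) * ‖v1 u k z‖^2 := by ring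
        _ ≤ _ := by have := h5 _ t0; gcongr
    have c3 : |ψ (‖u z‖^2) * ‖v1 u k z‖^2| ≤ B * ‖v1 u k z‖^2 := by
      rw [abs_of_nonneg (by have := h3 _ t0; positivity)]
      have := h4 _ t0
      gcongr
    simp only [Pi.add_apply]
    rw [mul_add, ← add_assoc, Real.norm_eq_abs, Real.norm_eq_abs]
    refine (abs_add_le _ _).trans (add_le_add ((abs_add_le _ _).trans ?_) le_rfl)
    linarith
  have hper : ∀ k, ∀ j : Fin n, ∀ p : Pt d n,
      F k (p.1, p.2 + (2*π) • (Pi.single j 1 : Fin n → ℝ)) = F k p := by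
    intro k j p
    simp only [hF]
    rw [h.2.1 j p, v1_per h.2.1 k j p]
  have hz : ∀ k, ∫ z, fderiv ℝ (F k) z (ev d n k) ∂(μP d n) = 0 := fun k =>
    ibp d n k (F k) (hFd k) (hper k) (hFint k) (hF'int k)
  have hs : ∫ z, ∑ k, fderiv ℝ (F k) z (ev d n k) ∂(μP d n) = 0 := by
    rw [integral_finsetSum _ fun k _ => hF'int k]
    exact Finset.sum_eq_zero fun k _ => hz k
  have hsi : Integrable (fun z => ∑ k, fderiv ℝ (F k) z (ev d n k)) (μP d n) :=
    integrable_finsetSum _ fun k _ => hF'int k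
  have : ∫ z, ψ (‖u z‖^2) * gd u z ∂(μP d n) ≤
      ∫ z, (∑ k, fderiv ℝ (F k) z (ev d n k)) + ψ (‖u z‖^2) * (‖u z‖ * ‖lap d n u z‖) ∂(μP d n) := by
    apply integral_mono I1 (hsi.add I2)
    intro z
    have t0 : 0 ≤ ‖u z‖^2 := by positivity
    have e : ∑ k, fderiv ℝ (F k) z (ev d n k) = (∑ k, ψ' (‖u z‖^2) * 2 * ⟪u z, v1 u k z⟫^2)
        + ψ (‖u z‖^2) * gd u z + ψ (‖u z‖^2) * ⟪u z, lap d n u z⟫ := by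
      simp only [(hderiv _ z).2, lap_eq, gd, inner_sum, Finset.mul_sum, mul_add,
        Finset.sum_add_distrib]
      ring
    simp only [Pi.add_apply]
    rw [e]
    have p1 : 0 ≤ ∑ k, ψ' (‖u z‖^2) * 2 * ⟪u z, v1 u k z⟫^2 := by
      apply Finset.sum_nonneg; intro k _
      have := h2 _ t0; positivity
    have p2 : -(‖u z‖ * ‖lap d n u z‖) ≤ ⟪u z, lap d n u z⟫ :=
      (abs_le.1 (abs_real_inner_le_norm _ _)).1
    have p3 := mul_le_mul_of_nonneg_left p2 (h3 _ t0)
    linarith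
  rw [integral_add hsi I2, hs, zero_add] at this
  exact this

end BNLS

namespace BNLS
open MeasureTheory Real Filter Set
open scoped ENNReal RealInnerProductSpace


lemma holder_real {α : Type*} [MeasurableSpace α] {μ : Measure α} (a b : α → ℝ)
    (ha : ∀ x, 0 ≤ a x) (hb : ∀ x, 0 ≤ b x) (hia : Integrable a μ) (hib : Integrable b μ)
    (p q : ℝ) (hp : 0 ≤ p) (hq : 0 ≤ q) (hpq : p + q = 1) :
    ∫⁻ x, ENNReal.ofReal (a x ^ p * b x ^ q) ∂μ ≤ ENNReal.ofReal ((∫ x, a x ∂μ) ^ p * (∫ x, b x ∂μ)^q) := by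
  have h := ENNReal.lintegral_mul_norm_pow_le (μ := μ) (f := fun x => ENNReal.ofReal (a x))
    (g := fun x => ENNReal.ofReal (b x)) hia.aestronglyMeasurable.aemeasurable.ennreal_ofReal
    hib.aestronglyMeasurable.aemeasurable.ennreal_ofReal hp hq hpq
  have ia : 0 ≤ ∫ x, a x ∂μ := integral_nonneg ha
  have ib : 0 ≤ ∫ x, b x ∂μ := integral_nonneg hb
  rw [← ofReal_integral_eq_lintegral_ofReal hia (Eventually.of_forall ha),
    ← ofReal_integral_eq_lintegral_ofReal hib (Eventually.of_forall hb),
    ENNReal.ofReal_rpow_of_nonneg ia hp, ENNReal.ofReal_rpow_of_nonneg ib hq,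
    ← ENNReal.ofReal_mul (by positivity)] at h
  refine le_trans (le_of_eq ?_) h
  congr 1; ext x
  rw [ENNReal.ofReal_rpow_of_nonneg (ha x) hp, ENNReal.ofReal_rpow_of_nonneg (hb x) hq,
    ← ENNReal.ofReal_mul (by have := ha x; positivity)]

/-- truncation of `1+t` -/
def W (ε t : ℝ) : ℝ := (1+t)/(1+ε*(1+t))

lemma W_pos {ε t : ℝ} (hε : 0 < ε) (ht : 0 ≤ t) : 0 < W ε t := by unfold W; positivity
lemma W_le {ε t : ℝ} (hε : 0 < ε) (ht : 0 ≤ t) : W ε t ≤ 1 + t := by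
  unfold W
  rw [div_le_iff₀ (by positivity)]
  have : 0 ≤ ε * (1+t)^2 := by positivity
  nlinarith
lemma W_bdd {ε t : ℝ} (hε : 0 < ε) (ht : 0 ≤ t) : W ε t ≤ 1/ε := by
  unfold W
  rw [div_le_div_iff₀ (by positivity) hε]
  nlinarith
lemma W_deriv {ε t : ℝ} (hε : 0 < ε) (ht : 0 ≤ t) : HasDerivAt (W ε) (1/(1+ε*(1+t))^2) t := by
  have h1 : HasDerivAt (fun t : ℝ => 1+t) 1 t := (hasDerivAt_id t).const_add 1
  have h2 : HasDerivAt (fun t : ℝ => 1+ε*(1+t)) (ε*1) t := (h1.const_mul ε).const_add 1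
  have := h1.div h2 (by positivity)
  refine this.congr_deriv ?_
  congr 1; ring
lemma W_tderiv {ε t : ℝ} (hε : 0 < ε) (ht : 0 ≤ t) : t * (1/(1+ε*(1+t))^2) ≤ W ε t := by
  unfold W
  rw [mul_one_div, div_le_div_iff₀ (by positivity) (by positivity)]
  have h : 1 ≤ 1 + ε*(1+t) := by have : 0 ≤ ε*(1+t) := by positivity
                                 linarith
  have h' : 0 ≤ 1 + ε*(1+t) := by linarith
  nlinarith [mul_nonneg ht h', mul_nonneg (mul_nonneg ht h') (sub_nonneg.2 h), mul_nonneg h' h']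
lemma Wpow_deriv {ε t : ℝ} (hε : 0 < ε) (ht : 0 ≤ t) (p : ℝ) :
    HasDerivAt (fun t => W ε t ^ p) ((1/(1+ε*(1+t))^2) * p * W ε t ^ (p-1)) t :=
  (W_deriv hε ht).rpow_const (Or.inl (W_pos hε ht).ne')
lemma Wpow_tderiv {ε t : ℝ} (hε : 0 < ε) (ht : 0 ≤ t) {p : ℝ} (hp : 0 ≤ p) :
    t * ((1/(1+ε*(1+t))^2) * p * W ε t ^ (p-1)) ≤ p * W ε t ^ p := by
  have h := W_tderiv hε ht
  have hw := W_pos hε ht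
  calc _ = (t * (1/(1+ε*(1+t))^2)) * (p * W ε t ^ (p-1)) := by ring
    _ ≤ W ε t * (p * W ε t ^ (p-1)) := by gcongr
    _ = p * W ε t ^ p := by
      rw [Real.rpow_sub_one hw.ne']; field_simp

lemma h_deriv {ε t : ℝ} (hε : 0 < ε) (ht : 0 ≤ t) {p q : ℝ} (hp : 0 ≤ p) (hp1 : p ≤ 1) (hq : 0 ≤ q) (hq1 : q ≤ 1) :
    ∃ h', HasDerivAt (fun t => W ε t ^ p * t * (1+t) ^ (-q)) h' t ∧
      |h'| ≤ 4 * (W ε t ^ p * (1+t) ^ (-q)) := by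
  have h1 := Wpow_deriv hε ht p
  have h2 := h1.mul (hasDerivAt_id t)
  have h3 : HasDerivAt (fun t : ℝ => (1+t) ^ (-q)) (1 * (-q) * (1+t)^(-q-1)) t :=
    ((hasDerivAt_id t).const_add 1).rpow_const (Or.inl (by simp; positivity))
  refine ⟨_, h2.mul h3, ?_⟩
  simp only [Pi.mul_apply, id]
  have hb : 0 < 1 + t := by linarith
  have hw := W_pos hε ht
  rw [Real.rpow_sub_one hb.ne']
  set w' := (1/(1+ε*(1+t))^2) * p * W ε t ^ (p-1) with hw'
  have w'0 : 0 ≤ w' := by positivity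
  have h4 : t * w' ≤ p * W ε t ^ p := Wpow_tderiv hε ht hp
  set X := W ε t ^ p
  have X0 : 0 ≤ X := by positivity
  set Y := (1+t)^(-q)
  have Y0 : 0 ≤ Y := by positivity
  have e : (w' * t + X * 1) * Y + X * t * (1 * -q * (Y/(1+t))) = (t*w' + X - X * (q * (t/(1+t)))) * Y := by
    field_simp; ring
  rw [e, abs_mul, abs_of_nonneg Y0, ← mul_assoc 4 X Y]
  refine mul_le_mul_of_nonneg_right ?_ Y0
  have f0 : 0 ≤ t/(1+t) := by positivity
  have f1 : t/(1+t) ≤ 1 := by rw [div_le_one hb]; linarith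
  have f2 : q * (t/(1+t)) ≤ 1 := by nlinarith
  have f3 : 0 ≤ q * (t/(1+t)) := by positivity
  have f4 : X * (q * (t/(1+t))) ≤ X := by nlinarith
  have f5 : 0 ≤ X * (q * (t/(1+t))) := by positivity
  have f6 : p * X ≤ X := by nlinarith
  have f7 : 0 ≤ t * w' := by positivity
  rw [abs_le]
  constructor <;> linarith

/-- The truncated power integral. -/
def Qe {d n : ℕ} (ε : ℝ) (u : Pt d n → ℂ) : ℝ :=
  ∫ z, W ε (‖u z‖^2) ^ (4/((d:ℝ)+n)) * ‖u z‖^2 ∂(μP d n)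

lemma alg {D Q M L T : ℝ} (hD : 2 ≤ D) (hQ : 0 ≤ Q) (hM : 0 ≤ M) (hL : 0 ≤ L)
    (hT : T ≤ M^(1/4+1/D) * Q^(3/4-1/D) + 8*D*((Q^(1/2:ℝ)*L^(1/2:ℝ))^(1/2:ℝ) * (M^(2/D)*Q^(1-2/D))^(1/2:ℝ)))
    (hT0 : 0 ≤ T)
    (h : Q ≤ 2 * T^(D/(D-1)) + 4 * M) :
    Q ≤ 8 * M + 2048 * M^(4/D) * (M + (8*D)^4 * L) := by
  have hb : 0 ≤ 2048 * M^(4/D) * (M + (8*D)^4 * L) := by positivity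
  by_cases hc : Q ≤ 8 * M
  · linarith
  push Not at hc
  have hQ0 : 0 < Q := by linarith
  have h1 : Q ≤ 4 * T^(D/(D-1)) := by linarith
  have hD1 : 0 < D - 1 := by linarith
  have h2 : Q^((D-1)/D) ≤ 4 * T := by
    calc Q^((D-1)/D) ≤ (4 * T^(D/(D-1)))^((D-1)/D) := by gcongr
      _ = 4^((D-1)/D) * T := by
        rw [Real.mul_rpow (by norm_num) (by positivity), ← Real.rpow_mul hT0]
        have : D/(D-1) * ((D-1)/D) = 1 := by field_simp
        rw [this, Real.rpow_one]
      _ ≤ 4^(1:ℝ) * T := by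
        gcongr
        · norm_num
        · rw [div_le_one (by linarith)]; linarith
      _ = 4 * T := by simp
  have e1 : (Q^(1/2:ℝ)*L^(1/2:ℝ))^(1/2:ℝ) * (M^(2/D)*Q^(1-2/D))^(1/2:ℝ)
      = M^(1/D) * Q^(3/4-1/D) * L^(1/4:ℝ) := by
    rw [Real.mul_rpow (by positivity) (by positivity), Real.mul_rpow (by positivity) (by positivity),
      ← Real.rpow_mul hQ, ← Real.rpow_mul hL, ← Real.rpow_mul hM, ← Real.rpow_mul hQ]
    have : (3/4 - 1/D : ℝ) = 1/2*(1/2) + (1-2/D)*(1/2) := by ring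
    rw [this, Real.rpow_add hQ0]
    have : (2/D*(1/2)) = 1/D := by ring
    rw [this]
    norm_num
    ring
  have e2 : M^(1/4+1/D) = M^(1/D) * M^(1/4:ℝ) := by
    rw [add_comm, Real.rpow_add_of_nonneg hM (by positivity) (by norm_num)]
  rw [e1, e2] at hT
  have e3 : Q^((D-1)/D) = Q^(3/4-1/D) * Q^(1/4:ℝ) := by
    rw [← Real.rpow_add hQ0]; congr 1; field_simp; ring
  have h3 : Q^(3/4-1/D) * Q^(1/4:ℝ) ≤ Q^(3/4-1/D) * (4 * M^(1/D) * (M^(1/4:ℝ) + 8*D*L^(1/4:ℝ))) := by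
    rw [← e3]; nlinarith
  have h4 := le_of_mul_le_mul_left h3 (by positivity)
  have p4 : ∀ x : ℝ, 0 ≤ x → (x^(1/4:ℝ))^4 = x := by
    intro x hx
    rw [← Real.rpow_natCast, ← Real.rpow_mul hx]; norm_num
  have h5 : Q ≤ (4 * M^(1/D) * (M^(1/4:ℝ) + 8*D*L^(1/4:ℝ)))^4 := by
    rw [← p4 Q hQ]; gcongr
  have e5 : (M^(1/D))^4 = M^(4/D) := by
    rw [← Real.rpow_natCast, ← Real.rpow_mul hM]; congr 1; push_cast; ring
  have h6 : (M^(1/4:ℝ) + 8*D*L^(1/4:ℝ))^4 ≤ 8 * (M + (8*D)^4*L) := by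
    have := add_pow_le (a := M^(1/4:ℝ)) (b := 8*D*L^(1/4:ℝ)) (by positivity) (by positivity) 4
    rw [mul_pow (8*D) (L^(1/4:ℝ)), p4 M hM, p4 L hL] at this
    linarith
  calc Q ≤ _ := h5
    _ = 256 * M^(4/D) * (M^(1/4:ℝ) + 8*D*L^(1/4:ℝ))^4 := by
      rw [mul_pow, mul_pow, e5]; norm_num
    _ ≤ 256 * M^(4/D) * (8 * (M + (8*D)^4*L)) := by gcongr
    _ ≤ _ := by linarith

end BNLS

namespace BNLS
open MeasureTheory Real Filter Set
open scoped ENNReal RealInnerProductSpace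


lemma holder_real' {α : Type*} [MeasurableSpace α] {μ : Measure α} (a b : α → ℝ)
    (ha : ∀ x, 0 ≤ a x) (hb : ∀ x, 0 ≤ b x) (hia : Integrable a μ) (hib : Integrable b μ)
    (p q : ℝ) (hp : 0 ≤ p) (hq : 0 ≤ q) (hpq : p + q = 1) :
    ∫ x, a x ^ p * b x ^ q ∂μ ≤ (∫ x, a x ∂μ) ^ p * (∫ x, b x ∂μ)^q := by
  have ia : 0 ≤ ∫ x, a x ∂μ := integral_nonneg ha
  have ib : 0 ≤ ∫ x, b x ∂μ := integral_nonneg hb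
  have hm : AEStronglyMeasurable (fun x => a x ^ p * b x ^ q) μ :=
    ((hia.aestronglyMeasurable.aemeasurable.pow_const p).mul
      (hib.aestronglyMeasurable.aemeasurable.pow_const q)).aestronglyMeasurable
  rw [integral_eq_lintegral_of_nonneg_ae (Eventually.of_forall fun x => by
    have := ha x; have := hb x; simp only [Pi.zero_apply]; positivity) hm]
  exact ENNReal.toReal_le_of_le_ofReal (by positivity) (holder_real a b ha hb hia hib p q hp hq hpq)

lemma pt1 {ε t D : ℝ} (hε : 0 < ε) (ht : 0 ≤ t) (hD : 2 ≤ D) :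
    W ε t ^ (4/D) * t ≤ 2 * (W ε t ^ (4*(D-1)/D^2) * t * (1+t)^(-(1/D)))^(D/(D-1)) + 4 * t := by
  have hw := W_pos hε ht
  have hD1 : 0 < D - 1 := by linarith
  have hb : 0 < 1 + t := by linarith
  have hg : 0 ≤ (W ε t ^ (4*(D-1)/D^2) * t * (1+t)^(-(1/D)))^(D/(D-1)) := by positivity
  rcases le_total t 1 with h | h
  · have : W ε t ^ (4/D) ≤ 4 := by
      calc W ε t ^ (4/D) ≤ 2 ^ (4/D) := by
            have := W_le hε ht
            gcongr; linarith
        _ ≤ (2:ℝ) ^ (2:ℝ) := by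
            gcongr
            · norm_num
            · rw [div_le_iff₀ (by linarith)]; linarith
        _ = 4 := by norm_num
    nlinarith
  · have ht0 : 0 < t := by linarith
    have e : (W ε t ^ (4*(D-1)/D^2) * t * (1+t)^(-(1/D)))^(D/(D-1)) =
        W ε t ^ (4/D) * t * (t/(1+t))^(1/(D-1)) := by
      rw [Real.mul_rpow (by positivity) (by positivity), Real.mul_rpow (by positivity) (by positivity),
        ← Real.rpow_mul hw.le, ← Real.rpow_mul hb.le, Real.div_rpow ht hb.le]
      have e1 : 4*(D-1)/D^2 * (D/(D-1)) = 4/D := by field_simp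
      have e2 : -(1/D) * (D/(D-1)) = -(1/(D-1)) := by field_simp
      have e3 : D/(D-1) = 1 + 1/(D-1) := by field_simp; ring
      rw [e1, e2, e3, Real.rpow_add ht0, Real.rpow_one, Real.rpow_neg hb.le]
      field_simp
    rw [e]
    have h2 : (1/2:ℝ) ≤ (t/(1+t))^(1/(D-1)) := by
      have hx : (1/2:ℝ) ≤ t/(1+t) := by rw [div_le_div_iff₀ (by norm_num) hb]; linarith
      calc (1/2:ℝ) = (1/2:ℝ)^(1:ℝ) := by simp
        _ ≤ (1/2:ℝ)^(1/(D-1)) := by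
          apply Real.rpow_le_rpow_of_exponent_ge (by norm_num) (by norm_num)
          rw [div_le_one hD1]; linarith
        _ ≤ _ := by gcongr
    have : 0 ≤ W ε t ^ (4/D) * t := by positivity
    nlinarith

lemma bneg {ε t q : ℝ} (hε : 0 < ε) (ht : 0 ≤ t) (hq : 0 ≤ q) : (1+t)^(-q) ≤ W ε t ^ (-q) :=
  Real.rpow_le_rpow_of_nonpos (W_pos hε ht) (W_le hε ht) (by linarith)

lemma tpow {t a b : ℝ} (ht : 0 ≤ t) (ha : 0 ≤ a) (hb : 0 ≤ b) (hab : a + b = 1) :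
    t ^ a * t ^ b = t := by
  rw [← Real.rpow_add_of_nonneg ht ha hb, hab, Real.rpow_one]

lemma pt2 {ε t D : ℝ} (hε : 0 < ε) (ht : 0 ≤ t) (hD : 2 ≤ D) :
    W ε t ^ (4*(D-1)/D^2) * t * (1+t)^(-(1/D)) ≤ t^(1/4+1/D) * (W ε t ^ (4/D) * t)^(3/4-1/D) := by
  have hw := W_pos hε ht
  have h0 : 1/D ≤ 1/2 := by rw [div_le_div_iff₀ (by linarith) (by norm_num)]; linarith
  have h00 : 0 ≤ 1/D := by positivity
  calc _ ≤ W ε t ^ (4*(D-1)/D^2) * t * W ε t ^(-(1/D)) := by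
        have := bneg hε ht h00
        gcongr
    _ = W ε t ^ (4/D*(3/4-1/D)) * t := by
        have : 4/D*(3/4-1/D) = 4*(D-1)/D^2 + (-(1/D)) := by field_simp; ring
        rw [this, Real.rpow_add hw]; ring
    _ = _ := by
        rw [Real.mul_rpow (by positivity) ht, ← Real.rpow_mul hw.le]
        have := tpow ht (a := 1/4+1/D) (b := 3/4-1/D) (by linarith) (by linarith) (by ring)
        generalize W ε t ^ (4/D*(3/4-1/D)) = A
        calc A * t = A * (t ^ (1/4+1/D) * t ^ (3/4-1/D)) := by rw [this]
          _ = _ := by ring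

lemma pt3 {ε r y D : ℝ} (hε : 0 < ε) (hr : 0 ≤ r) (hy : 0 ≤ y) (hD : 2 ≤ D) :
    W ε (r^2) ^ (4*(D-1)/D^2) * (1+r^2)^(-(1/D)) * (r * y) ≤
      (W ε (r^2) ^ (2/D) * y^2)^(1/2:ℝ) * (W ε (r^2) ^ (4/D*(1-2/D)) * r^2)^(1/2:ℝ) := by
  have ht : 0 ≤ r^2 := by positivity
  have hw := W_pos hε ht
  have h00 : 0 ≤ 1/D := by positivity
  have sq : ∀ x : ℝ, 0 ≤ x → (x^2)^(1/2:ℝ) = x := by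
    intro x hx
    rw [← Real.sqrt_eq_rpow, Real.sqrt_sq hx]
  calc _ ≤ W ε (r^2) ^ (4*(D-1)/D^2) * W ε (r^2) ^(-(1/D)) * (r*y) := by
        have := bneg hε ht h00
        gcongr
    _ = _ := by
        rw [Real.mul_rpow (by positivity) (by positivity), Real.mul_rpow (by positivity) (by positivity),
          ← Real.rpow_mul hw.le, ← Real.rpow_mul hw.le, sq r hr, sq y hy, ← Real.rpow_add hw]
        have : 4*(D-1)/D^2 + (-(1/D)) = 2/D*(1/2) + 4/D*(1-2/D)*(1/2) := by field_simp; ring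
        rw [this, Real.rpow_add hw]; ring

lemma pt4 {ε t D : ℝ} (hε : 0 < ε) (ht : 0 ≤ t) (hD : 2 ≤ D) :
    W ε t ^ (4/D*(1-2/D)) * t = t^(2/D) * (W ε t ^ (4/D) * t)^(1-2/D) := by
  have hw := W_pos hε ht
  have h0 : 2/D ≤ 1 := by rw [div_le_one (by linarith)]; linarith
  rw [Real.mul_rpow (by positivity) ht, ← Real.rpow_mul hw.le]
  have := tpow ht (a := 2/D) (b := 1-2/D) (by positivity) (by linarith) (by ring)
  generalize W ε t ^ (4/D*(1-2/D)) = A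
  calc A * t = A * (t ^ (2/D) * t ^ (1-2/D)) := by rw [this]
    _ = _ := by ring

lemma W_contDiff {d n : ℕ} {u : Pt d n → ℂ} (h : ContDiff ℝ 2 u) {ε : ℝ} (hε : 0 < ε) (p : ℝ) :
    ContDiff ℝ 1 (fun z => W ε (‖u z‖^2) ^ p) := by
  have h1 : ContDiff ℝ 1 (fun z => ‖u z‖^2) := (h.of_le (by norm_num)).norm_sq ℝ
  apply ContDiff.rpow_const_of_ne
  · unfold W
    apply ContDiff.div
    · exact contDiff_const.add h1
    · exact contDiff_const.add (contDiff_const.mul (contDiff_const.add h1))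
    · intro z; positivity
  · intro z; exact (W_pos hε (by positivity)).ne'

lemma W_int {d n : ℕ} {u : Pt d n → ℂ} (h : InH2 d n u) {ε : ℝ} (hε : 0 < ε) {p : ℝ} (hp : 0 ≤ p) :
    Integrable (fun z => W ε (‖u z‖^2) ^ p * ‖u z‖^2) (μP d n) := by
  refine h.2.2.1.bdd_mul (c := (1/ε)^p) (W_contDiff h.1 hε p).continuous.aestronglyMeasurable
    (Eventually.of_forall fun z => ?_)
  have hw := W_pos hε (t := ‖u z‖^2) (by positivity)
  rw [Real.norm_of_nonneg (by positivity)]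
  have := W_bdd hε (t := ‖u z‖^2) (by positivity)
  gcongr

lemma gn {d n : ℕ} (hd : 1 ≤ d) (hn : 1 ≤ n) {u : Pt d n → ℂ} (h : InH2 d n u) {ε : ℝ} (hε : 0 < ε) :
    Qe ε u ≤ 8 * Mass d n u + 2048 * Mass d n u ^ (4/((d:ℝ)+n)) *
      (Mass d n u + (8*((d:ℝ)+n))^4 * lapSq d n u) := by
  have hd' : (1:ℝ) ≤ d := by exact_mod_cast hd
  have hn' : (1:ℝ) ≤ n := by exact_mod_cast hn
  have hsob := sobolev d n hd hn (fun z => W ε (‖u z‖^2) ^ (4*(((d:ℝ)+n)-1)/((d:ℝ)+n)^2) * ‖u z‖^2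
      * (1+‖u z‖^2)^(-(1/((d:ℝ)+n)))) ?_
  swap
  · have h1 : ContDiff ℝ 1 (fun z => ‖u z‖^2) := (h.1.of_le (by norm_num)).norm_sq ℝ
    refine ((W_contDiff h.1 hε _).mul h1).mul ((contDiff_const.add h1).rpow_const_of_ne ?_)
    intro z; positivity
  have hcard : ((Fintype.card (Fin d ⊕ Fin n) : ℕ) : ℝ) = (d:ℝ)+n := by simp
  unfold Qe
  set D : ℝ := (d:ℝ)+n with hDdef
  have hD : 2 ≤ D := by linarith
  have hD1 : 0 < D - 1 := by linarith
  have h2D : 2/D ≤ 1 := by rw [div_le_one (by linarith)]; linarith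
  have h1D : 1/D ≤ 1/2 := by rw [div_le_div_iff₀ (by linarith) (by norm_num)]; linarith
  have h1D0 : 0 ≤ 1/D := by positivity
  set p : ℝ := 4*(D-1)/D^2 with hp
  have hp0 : 0 ≤ p := by positivity
  have hp1 : p ≤ 1 := by
    rw [hp, div_le_one (by positivity)]; nlinarith [sq_nonneg (D-2)]
  set g : Pt d n → ℝ := fun z => W ε (‖u z‖^2) ^ p * ‖u z‖^2 * (1+‖u z‖^2)^(-(1/D)) with hg
  set Q := ∫ z, W ε (‖u z‖^2) ^ (4/D) * ‖u z‖^2 ∂(μP d n) with hQ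
  set M := Mass d n u with hM
  set L := lapSq d n u with hL
  have t0 : ∀ z, 0 ≤ ‖u z‖^2 := fun z => by positivity
  have hw : ∀ z, 0 < W ε (‖u z‖^2) := fun z => W_pos hε (t0 z)
  have hg0 : ∀ z, 0 ≤ g z := fun z => by have := hw z; simp only [hg]; positivity
  have hQi : Integrable (fun z => W ε (‖u z‖^2) ^ (4/D) * ‖u z‖^2) (μP d n) := W_int h hε (by positivity)
  have hQ0 : 0 ≤ Q := integral_nonneg fun z => by have := hw z; positivity
  have hM0 : 0 ≤ M := integral_nonneg fun z => by positivity
  have hL0 : 0 ≤ L := integral_nonneg fun z => by positivity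
  obtain ⟨I1, I2, hP⟩ := weighted h (fun t => W ε t ^ (2/D))
    (fun t => (1/(1+ε*(1+t))^2) * (2/D) * W ε t ^ (2/D-1)) ((1/ε)^(2/D))
    (fun t ht => Wpow_deriv hε ht _)
    (fun t ht => by have := W_pos hε ht; positivity)
    (fun t ht => by have := W_pos hε ht; positivity)
    (fun t ht => by have := W_pos hε ht; have := W_bdd hε ht; gcongr)
    (fun t ht => by
      have a1 := Wpow_tderiv hε ht (p := 2/D) (by positivity)
      have a2 := W_pos hε ht
      have a3 : W ε t ^ (2/D) ≤ (1/ε)^(2/D) := by have := W_bdd hε ht; gcongr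
      have a4 : 0 ≤ W ε t ^ (2/D) := by positivity
      nlinarith)
  set P := ∫ z, W ε (‖u z‖^2) ^ (2/D) * gd u z ∂(μP d n) with hPdef
  have hPb : P ≤ Q^(1/2:ℝ) * L^(1/2:ℝ) := by
    refine hP.trans ?_
    have := holder_real' (μ := μP d n) (fun z => W ε (‖u z‖^2) ^ (4/D) * ‖u z‖^2)
      (fun z => ‖lap d n u z‖^2) (fun z => by have := hw z; positivity) (fun z => by positivity)
      hQi (lap_int h) (1/2) (1/2) (by norm_num) (by norm_num) (by norm_num)
    refine le_trans (le_of_eq ?_) this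
    congr 1; ext z
    have sq : ∀ x : ℝ, 0 ≤ x → (x^2)^(1/2:ℝ) = x := by
      intro x hx
      rw [← Real.sqrt_eq_rpow, Real.sqrt_sq hx]
    rw [Real.mul_rpow (by have := hw z; positivity) (by positivity), sq _ (norm_nonneg _), sq _ (norm_nonneg _),
      ← Real.rpow_mul (hw z).le]
    have : 4/D*(1/2) = 2/D := by ring
    rw [this]; ring
  have hRi : Integrable (fun z => W ε (‖u z‖^2) ^ (4/D*(1-2/D)) * ‖u z‖^2) (μP d n) :=
    W_int h hε (mul_nonneg (by positivity) (by linarith))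
  set R := ∫ z, W ε (‖u z‖^2) ^ (4/D*(1-2/D)) * ‖u z‖^2 ∂(μP d n) with hR
  have hR0 : 0 ≤ R := integral_nonneg fun z => by have := hw z; positivity
  have hRb : R ≤ M^(2/D) * Q^(1-2/D) := by
    have := holder_real' (μ := μP d n) (fun z => ‖u z‖^2) (fun z => W ε (‖u z‖^2) ^ (4/D) * ‖u z‖^2)
      (fun z => by positivity) (fun z => by have := hw z; positivity) 
      h.2.2.1 hQi (2/D) (1-2/D) (by positivity) (by linarith) (by ring)
    refine le_trans (le_of_eq ?_) this
    exact integral_congr_ae (Eventually.of_forall fun z => pt4 hε (t0 z) hD)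
  have hP0 : 0 ≤ P := integral_nonneg fun z => by
    have := hw z; have : 0 ≤ gd u z := by unfold gd; positivity
    positivity
  have hS1 : ∫⁻ z, ‖g z‖ₑ ∂(μP d n) ≤ ENNReal.ofReal (M^(1/4+1/D) * Q^(3/4-1/D)) := by
    have := holder_real (μ := μP d n) (fun z => ‖u z‖^2) (fun z => W ε (‖u z‖^2) ^ (4/D) * ‖u z‖^2)
      (fun z => by positivity) (fun z => by have := hw z; positivity) 
      h.2.2.1 hQi (1/4+1/D) (3/4-1/D) (by positivity) (by linarith) (by ring)
    refine le_trans (lintegral_mono fun z => ?_) this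
    rw [Real.enorm_of_nonneg (hg0 z)]
    exact ENNReal.ofReal_le_ofReal (pt2 hε (t0 z) hD)
  have hS2 : ∀ k, ∫⁻ z, ‖fderiv ℝ g z (ev d n k)‖ₑ ∂(μP d n) ≤
      ENNReal.ofReal (8 * (P^(1/2:ℝ) * R^(1/2:ℝ))) := by
    intro k
    have hv : Integrable (fun z => W ε (‖u z‖^2) ^ (2/D) * ‖v1 u k z‖^2) (μP d n) := by
      refine I1.mono' ((W_contDiff h.1 hε _).continuous.mul
        ((v1_contDiff h.1 k).continuous.norm.pow 2)).aestronglyMeasurable (Eventually.of_forall fun z => ?_)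
      have := hw z
      rw [Real.norm_of_nonneg (by positivity)]
      gcongr
      exact Finset.single_le_sum (f := fun k => ‖v1 u k z‖^2) (fun _ _ => by positivity) (Finset.mem_univ k)
    have hvP : ∫ z, W ε (‖u z‖^2) ^ (2/D) * ‖v1 u k z‖^2 ∂(μP d n) ≤ P := by
      apply integral_mono hv I1
      intro z
      have := hw z
      simp only
      gcongr
      exact Finset.single_le_sum (f := fun k => ‖v1 u k z‖^2) (fun _ _ => by positivity) (Finset.mem_univ k)
    have hv0 : 0 ≤ ∫ z, W ε (‖u z‖^2) ^ (2/D) * ‖v1 u k z‖^2 ∂(μP d n) :=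
      integral_nonneg fun z => by have := hw z; positivity
    have hh := holder_real (μ := μP d n) _ _ (fun z => by have := hw z; positivity)
      (fun z => by have := hw z; positivity) hv hRi (1/2) (1/2) (by norm_num) (by norm_num) (by norm_num)
    have hpt : ∀ z, ‖fderiv ℝ g z (ev d n k)‖ₑ ≤ ENNReal.ofReal 8 *
        ENNReal.ofReal ((W ε (‖u z‖^2) ^ (2/D) * ‖v1 u k z‖^2)^(1/2:ℝ) *
          (W ε (‖u z‖^2) ^ (4/D*(1-2/D)) * ‖u z‖^2)^(1/2:ℝ)) := by
      intro z
      rw [← ENNReal.ofReal_mul (by norm_num), ← ofReal_norm]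
      apply ENNReal.ofReal_le_ofReal
      obtain ⟨h', hh1, hh2⟩ := h_deriv hε (t0 z) hp0 hp1 (q := 1/D) (by positivity) (by linarith)
      have hud : Differentiable ℝ u := h.1.differentiable (by norm_num)
      have a4 := hh1.comp_hasFDerivAt z (hud z).hasFDerivAt.norm_sq
      have a4' : HasFDerivAt g _ z := a4
      rw [a4'.fderiv]
      have e1 : fderiv ℝ u z (ev d n k) = v1 u k z := rfl
      have e2 : ‖(h' • (2 • (innerSL ℝ (u z)).comp (fderiv ℝ u z))) (ev d n k)‖ ≤
          |h'| * (2 * (‖u z‖ * ‖v1 u k z‖)) := by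
        have := abs_real_inner_le_norm (u z) (v1 u k z)
        simp only [_root_.smul_apply, ContinuousLinearMap.comp_apply, e1, innerSL_apply_apply,
          smul_eq_mul, nsmul_eq_mul, Real.norm_eq_abs, abs_mul]
        rw [Nat.cast_ofNat, abs_two]
        gcongr
      refine le_trans e2 ?_
      have e3 := pt3 (y := ‖v1 u k z‖) hε (norm_nonneg (u z)) (norm_nonneg _) hD
      calc |h'| * (2 * (‖u z‖ * ‖v1 u k z‖)) ≤
          4 * (W ε (‖u z‖^2) ^ p * (1+‖u z‖^2)^(-(1/D))) * (2 * (‖u z‖ * ‖v1 u k z‖)) := by gcongr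
        _ = 8 * (W ε (‖u z‖^2) ^ p * (1+‖u z‖^2)^(-(1/D)) * (‖u z‖ * ‖v1 u k z‖)) := by ring
        _ ≤ _ := by gcongr
    refine (lintegral_mono hpt).trans ?_
    rw [lintegral_const_mul' _ _ ENNReal.ofReal_ne_top, ENNReal.ofReal_mul (by norm_num)]
    gcongr
    refine hh.trans (ENNReal.ofReal_le_ofReal ?_)
    gcongr
  have hS : ∫⁻ z, (‖g z‖ₑ + ∑ k, ‖fderiv ℝ g z (ev d n k)‖ₑ) ∂(μP d n) ≤
      ENNReal.ofReal (M^(1/4+1/D) * Q^(3/4-1/D) + 8*D*(P^(1/2:ℝ) * R^(1/2:ℝ))) := by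
    have hgm : ∀ k, Measurable fun z => ‖fderiv ℝ g z (ev d n k)‖ₑ := fun k =>
      (measurable_fderiv_apply_const ℝ g (ev d n k)).enorm
    rw [lintegral_add_right _ (Finset.measurable_sum _ fun k _ => hgm k),
      lintegral_finsetSum _ fun k _ => hgm k, ENNReal.ofReal_add (by positivity) (by positivity)]
    gcongr
    refine (Finset.sum_le_sum fun k _ => hS2 k).trans ?_
    rw [Finset.sum_const, nsmul_eq_mul, Finset.card_univ, ← ENNReal.ofReal_natCast,
      ← ENNReal.ofReal_mul (by positivity), hcard]
    apply le_of_eq; congr 1; ring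
  set T := M^(1/4+1/D) * Q^(3/4-1/D) + 8*D*(P^(1/2:ℝ) * R^(1/2:ℝ)) with hT
  have hT0 : 0 ≤ T := by positivity
  have hfin : ∫⁻ z, ‖g z‖ₑ ^ (D/(D-1)) ∂(μP d n) ≤ ENNReal.ofReal (T^(D/(D-1))) := by
    refine hsob.trans ?_
    rw [← ENNReal.ofReal_rpow_of_nonneg hT0 (by positivity)]
    exact ENNReal.rpow_le_rpow hS (by positivity)
  refine alg hD hQ0 hM0 hL0 (T := T) ?_ hT0 ?_
  · rw [hT]; gcongr
  · have : ENNReal.ofReal Q ≤ ENNReal.ofReal (2 * T^(D/(D-1)) + 4 * M) := by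
      rw [hQ, ofReal_integral_eq_lintegral_ofReal hQi (Eventually.of_forall fun z => by
        have := hw z; simp only [Pi.zero_apply]; positivity)]
      have hMe : ENNReal.ofReal (4 * M) = ∫⁻ z, ENNReal.ofReal (4 * ‖u z‖^2) ∂(μP d n) := by
        rw [← ofReal_integral_eq_lintegral_ofReal (h.2.2.1.const_mul 4)
          (Eventually.of_forall fun z => by simp only [Pi.zero_apply]; positivity), integral_const_mul]
        rfl
      rw [ENNReal.ofReal_add (by positivity) (by positivity), hMe]
      calc _ ≤ ∫⁻ z, (ENNReal.ofReal 2 * ‖g z‖ₑ ^ (D/(D-1)) + ENNReal.ofReal (4 * ‖u z‖^2)) ∂(μP d n) := by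
            apply lintegral_mono
            intro z
            simp only
            rw [Real.enorm_of_nonneg (hg0 z), ENNReal.ofReal_rpow_of_nonneg (hg0 z) (by positivity),
              ← ENNReal.ofReal_mul (by norm_num), ← ENNReal.ofReal_add (by have := hg0 z; positivity) (by positivity)]
            exact ENNReal.ofReal_le_ofReal (pt1 hε (t0 z) hD)
        _ = ENNReal.ofReal 2 * (∫⁻ z, ‖g z‖ₑ ^ (D/(D-1)) ∂(μP d n)) + ∫⁻ z, ENNReal.ofReal (4 * ‖u z‖^2) ∂(μP d n) := by
            have hmm : Measurable fun z => ENNReal.ofReal (4 * ‖u z‖^2) :=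
              (continuous_const.mul (h.1.continuous.norm.pow 2)).measurable.ennreal_ofReal
            rw [lintegral_add_right _ hmm,
              lintegral_const_mul' _ _ ENNReal.ofReal_ne_top]
        _ ≤ _ := by
            rw [ENNReal.ofReal_mul (by norm_num)]
            gcongr
    exact (ENNReal.ofReal_le_ofReal_iff (by positivity)).1 this

end BNLS

namespace BNLS
open MeasureTheory Real Filter Set
open scoped ENNReal RealInnerProductSpace


lemma dX_smul {d n : ℕ} (s : ℝ) (i) (u : Pt d n → ℂ) : dX d n i (s • u) = s • dX d n i u := by
  ext z
  simp only [dX, Pi.smul_apply]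
  rw [fderiv_const_smul_field]; rfl

lemma dY_smul {d n : ℕ} (s : ℝ) (i) (u : Pt d n → ℂ) : dY d n i (s • u) = s • dY d n i u := by
  ext z
  simp only [dY, Pi.smul_apply]
  rw [fderiv_const_smul_field]; rfl

lemma nsq {s : ℝ} (w : ℂ) : ‖s • w‖^2 = s^2 * ‖w‖^2 := by
  rw [norm_smul, mul_pow, Real.norm_eq_abs, sq_abs]

lemma lap_smul {d n : ℕ} (s : ℝ) (u : Pt d n → ℂ) : lap d n (s • u) = s • lap d n u := by
  ext z
  simp only [lap, lapX, lapY, dX_smul, dY_smul, Pi.smul_apply, smul_add, Finset.smul_sum]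

lemma Mass_smul {d n : ℕ} (s : ℝ) (u : Pt d n → ℂ) : Mass d n (s • u) = s^2 * Mass d n u := by
  simp only [Mass, Pi.smul_apply, nsq, integral_const_mul]

lemma lapSq_smul {d n : ℕ} (s : ℝ) (u : Pt d n → ℂ) : lapSq d n (s • u) = s^2 * lapSq d n u := by
  simp only [lapSq, lap_smul, Pi.smul_apply, nsq, integral_const_mul]

lemma gradSq_smul {d n : ℕ} (s : ℝ) (u : Pt d n → ℂ) : gradSq d n (s • u) = s^2 * gradSq d n u := by
  simp only [gradSq, gradXSq, gradYSq, dX_smul, dY_smul, Pi.smul_apply, nsq, integral_const_mul,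
    ← Finset.mul_sum, mul_add]

lemma Npow_smul {d n : ℕ} {s : ℝ} (hs : 0 ≤ s) (p : ℝ) (u : Pt d n → ℂ) :
    Npow d n p (s • u) = s^p * Npow d n p u := by
  simp only [Npow, Pi.smul_apply, norm_smul, Real.norm_of_nonneg hs, Real.mul_rpow hs (norm_nonneg _),
    integral_const_mul]

lemma InH2_smul {d n : ℕ} (s : ℝ) {u : Pt d n → ℂ} (h : InH2 d n u) : InH2 d n (s • u) := by
  obtain ⟨h1, h2, h3, h4, h5⟩ := h
  refine ⟨contDiff_const.smul h1, fun j p => ?_, ?_, ?_, ?_⟩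
  · simp only [Pi.smul_apply]; rw [h2 j p]
  · simp only [Pi.smul_apply, nsq]; exact h3.const_mul _
  · simp only [dX_smul, dY_smul, Pi.smul_apply, nsq, ← Finset.mul_sum, ← mul_add]
    exact h4.const_mul _
  · have : hessInt d n (s • u) = fun z => s^2 * hessInt d n u z := by
      ext z
      simp only [hessInt, dX_smul, dY_smul, Pi.smul_apply, nsq, ← Finset.mul_sum, ← mul_add]
    rw [this]; exact h5.const_mul _

lemma scale_mem {d n : ℕ} {z x : ℝ} (hz : 0 < z) (hx : 0 < x) {u : Pt d n → ℂ} (h : u ∈ Sset d n z) :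
    √(x/z) • u ∈ Sset d n x := by
  refine ⟨InH2_smul _ h.1, ?_⟩
  rw [Mass_smul, h.2, Real.sq_sqrt (by positivity)]
  field_simp

lemma En_scale {d n : ℕ} {r : ℝ} (hr : 0 ≤ r) (β α : ℝ) (u : Pt d n → ℂ) :
    En d n β α (√r • u) = r * ((1/2) * lapSq d n u + (β/2) * gradSq d n u)
      - r^((α+2)/2) * ((1/(α+2)) * Npow d n (α+2) u) := by
  unfold En
  rw [lapSq_smul, gradSq_smul, Npow_smul (Real.sqrt_nonneg _), Real.sq_sqrt hr, Real.sqrt_eq_rpow,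
    ← Real.rpow_mul hr]
  have : 1/2*(α+2) = (α+2)/2 := by ring
  rw [this]; ring

lemma mC_concave {d n : ℕ} {β α : ℝ} (hα : 0 < α)
    (hb : ∀ c, 0 < c → BddBelow (En d n β α '' Sset d n c)) :
    ConcaveOn ℝ (Ioi 0) (fun c => mC d n β α c) := by
  refine ⟨convex_Ioi 0, ?_⟩
  intro x hx y hy a b ha hb' hab
  have hx : 0 < x := hx
  have hy : 0 < y := hy
  simp only [smul_eq_mul]
  have hz : 0 < a * x + b * y := (convex_Ioi (0:ℝ)) hx hy ha hb' hab
  set z := a * x + b * y with hzd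
  rcases (Sset d n z).eq_empty_or_nonempty with he | hne
  · have hem : ∀ c, 0 < c → Sset d n c = ∅ := by
      intro c hc
      rw [Set.eq_empty_iff_forall_notMem]
      intro u hu
      have := scale_mem hc hz hu
      rw [he] at this
      exact this
    simp [mC, hem x hx, hem y hy, he]
  · apply le_csInf (hne.image _)
    rintro _ ⟨u, hu, rfl⟩
    have ex : mC d n β α x ≤ En d n β α (√(x/z) • u) := csInf_le (hb x hx) ⟨_, scale_mem hz hx hu, rfl⟩
    have ey : mC d n β α y ≤ En d n β α (√(y/z) • u) := csInf_le (hb y hy) ⟨_, scale_mem hz hy hu, rfl⟩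
    rw [En_scale (by positivity)] at ex ey
    have eu : En d n β α u = ((1/2) * lapSq d n u + (β/2) * gradSq d n u) - ((1/(α+2)) * Npow d n (α+2) u) := rfl
    have hB : 0 ≤ (1/(α+2)) * Npow d n (α+2) u :=
      mul_nonneg (by positivity) (integral_nonneg fun z => by positivity)
    rw [eu]
    generalize (1/2) * lapSq d n u + (β/2) * gradSq d n u = A at *
    generalize (1/(α+2)) * Npow d n (α+2) u = B at *
    have hs : a * (x/z) + b * (y/z) = 1 := by
      rw [← mul_div_assoc, ← mul_div_assoc, ← add_div, ← hzd, div_self hz.ne']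
    have hc := (convexOn_rpow (p := (α+2)/2) (by linarith)).2 (x := x/z) (y := y/z)
      (mem_Ici.2 (by positivity)) (mem_Ici.2 (by positivity)) ha hb' hab
    simp only [smul_eq_mul, hs, Real.one_rpow] at hc
    have e1 := mul_le_mul_of_nonneg_left ex ha
    have e2 := mul_le_mul_of_nonneg_left ey hb'
    have e3 := mul_le_mul_of_nonneg_right hc hB
    have e4 : A = (a * (x/z) + b * (y/z)) * A := by rw [hs, one_mul]
    nlinarith

end BNLS

namespace BNLS
open MeasureTheory Real Filter Set
open scoped ENNReal RealInnerProductSpace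


lemma young_pow {r s δ : ℝ} (hr : 0 < r) (hrs : r < s) (hδ : 0 < δ) :
    ∃ C, 0 ≤ C ∧ ∀ b : ℝ, 0 < b → b ^ r ≤ δ * b ^ s + C := by
  refine ⟨((1/δ)^(1/(s-r)))^r, by positivity, fun b hb => ?_⟩
  rcases le_total b ((1/δ)^(1/(s-r))) with h | h
  · have : b ^ r ≤ ((1/δ)^(1/(s-r)))^r := by gcongr
    have : 0 ≤ δ * b^s := by positivity
    linarith
  · have hsr : 0 < s - r := by linarith
    have h1 : 1/δ ≤ b^(s-r) := by
      calc 1/δ = ((1/δ)^(1/(s-r)))^(s-r) := by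
            rw [← Real.rpow_mul (by positivity), one_div_mul_cancel hsr.ne', Real.rpow_one]
        _ ≤ _ := by gcongr
    have h2 : b^s = b^r * b^(s-r) := by rw [← Real.rpow_add hb]; congr 1; ring
    have h3 : 1 ≤ δ * b^(s-r) := by
      calc (1:ℝ) = δ * (1/δ) := by field_simp
        _ ≤ _ := by gcongr
    have h4 : 0 ≤ ((1/δ)^(1/(s-r)))^r := by positivity
    have h5 : 0 < b^r := by positivity
    rw [h2]; nlinarith

lemma W_tendsto (t : ℝ) : Tendsto (fun k : ℕ => W (1/((k:ℝ)+1)) t) atTop (nhds (1+t)) := by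
  have h := tendsto_one_div_add_atTop_nhds_zero_nat (𝕜 := ℝ)
  have h2 : Tendsto (fun k : ℕ => 1 + (1/((k:ℝ)+1)) * (1+t)) atTop (nhds (1 + 0 * (1+t))) :=
    tendsto_const_nhds.add (h.mul_const _)
  have h3 := (tendsto_const_nhds (x := 1+t)).div h2 (by norm_num)
  have e : (fun k : ℕ => W (1/((k:ℝ)+1)) t) = ((fun _ => 1+t) / fun k : ℕ => 1 + (1/((k:ℝ)+1)) * (1+t)) := by
    ext k; rfl
  rw [e]
  simpa using h3

lemma npow_le {d n : ℕ} (hd : 1 ≤ d) (hn : 1 ≤ n) {α c η : ℝ} (hα : 0 < α) (hα' : α < 8 / ((d:ℝ)+n))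
    (hc : 0 < c) (hη : 0 < η) : ∃ C, ∀ u ∈ Sset d n c, Npow d n (α+2) u ≤ η * lapSq d n u + C := by
  have hd' : (1:ℝ) ≤ d := by exact_mod_cast hd
  have hn' : (1:ℝ) ≤ n := by exact_mod_cast hn
  have hD : 0 < (d:ℝ)+n := by linarith
  set s : ℝ := 4/((d:ℝ)+n) with hs
  have hrs : α/2 < s := by
    have : 8/((d:ℝ)+n) = 2 * s := by rw [hs]; ring
    linarith
  set K2 : ℝ := 2048 * c^s * (8*((d:ℝ)+n))^4 with hK2
  set K1 : ℝ := 8*c + 2048 * c^s * c with hK1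
  have hK2p : 0 < K2 := by positivity
  obtain ⟨C, hC0, hC⟩ := young_pow (r := α/2) (s := s) (δ := η/K2) (by positivity) hrs (by positivity)
  refine ⟨η/K2*K1 + C * c, fun u hu => ?_⟩
  obtain ⟨h, hM⟩ := hu
  have hL0 : 0 ≤ lapSq d n u := integral_nonneg fun z => by positivity
  have huc := h.1.continuous
  have t0 : ∀ z, 0 ≤ ‖u z‖^2 := fun z => by positivity
  have key : ∀ k : ℕ, ∫⁻ z, ENNReal.ofReal (W (1/((k:ℝ)+1)) (‖u z‖^2) ^ (α/2) * ‖u z‖^2) ∂(μP d n) ≤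
      ENNReal.ofReal (η * lapSq d n u + (η/K2*K1 + C * c)) := by
    intro k
    have hε : 0 < 1/((k:ℝ)+1) := by positivity
    have hw : ∀ z, 0 < W (1/((k:ℝ)+1)) (‖u z‖^2) := fun z => W_pos hε (t0 z)
    have g := gn hd hn h hε
    rw [hM, ← hs] at g
    unfold Qe at g
    rw [← hs] at g
    generalize 1/((k:ℝ)+1) = ε at *
    have i1 := W_int h hε (p := α/2) (by positivity)
    have i2 := W_int h hε (p := s) (by positivity)
    rw [← ofReal_integral_eq_lintegral_ofReal i1 (Eventually.of_forall fun z => by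
      have := hw z; simp only [Pi.zero_apply]; positivity)]
    apply ENNReal.ofReal_le_ofReal
    calc _ ≤ ∫ z, (η/K2 * (W ε (‖u z‖^2) ^ s * ‖u z‖^2) + C * ‖u z‖^2) ∂(μP d n) := by
          apply integral_mono i1 ((i2.const_mul _).add (h.2.2.1.const_mul _))
          intro z
          have := mul_le_mul_of_nonneg_right (hC _ (hw z)) (t0 z)
          simp only [Pi.add_apply]
          linarith
      _ = η/K2 * (∫ z, W ε (‖u z‖^2) ^ s * ‖u z‖^2 ∂(μP d n)) + C * Mass d n u := by
          rw [integral_add (i2.const_mul _) (h.2.2.1.const_mul _), integral_const_mul, integral_const_mul]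
          rfl
      _ ≤ η/K2 * (K1 + K2 * lapSq d n u) + C * c := by
          rw [hM]
          gcongr
          refine g.trans (le_of_eq ?_)
          rw [hK1, hK2]; ring
      _ = _ := by field_simp; ring
  have fat : ∫⁻ z, ENNReal.ofReal ((1 + ‖u z‖^2) ^ (α/2) * ‖u z‖^2) ∂(μP d n) ≤
      ENNReal.ofReal (η * lapSq d n u + (η/K2*K1 + C * c)) := by
    have hl : ∀ z, ENNReal.ofReal ((1 + ‖u z‖^2) ^ (α/2) * ‖u z‖^2) =
        liminf (fun k : ℕ => ENNReal.ofReal (W (1/((k:ℝ)+1)) (‖u z‖^2) ^ (α/2) * ‖u z‖^2)) atTop := by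
      intro z
      refine (Tendsto.liminf_eq ?_).symm
      refine ENNReal.tendsto_ofReal (Tendsto.mul_const _ ?_)
      exact (W_tendsto _).rpow_const (Or.inr (by positivity))
    simp_rw [hl]
    refine (lintegral_liminf_le fun k => ?_).trans ?_
    · exact ((W_contDiff h.1 (by positivity) _).continuous.mul (huc.norm.pow 2)).measurable.ennreal_ofReal
    · refine (liminf_le_liminf (Eventually.of_forall key)).trans ?_
      simp
  unfold Npow
  rw [integral_eq_lintegral_of_nonneg_ae (Eventually.of_forall fun z => by
    simp only [Pi.zero_apply]; positivity)
    (huc.norm.rpow_const fun _ => Or.inr (by positivity)).aestronglyMeasurable]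
  apply ENNReal.toReal_le_of_le_ofReal (by positivity)
  refine le_trans (lintegral_mono fun z => ENNReal.ofReal_le_ofReal ?_) fat
  rw [Real.rpow_add_of_nonneg (norm_nonneg _) hα.le (by norm_num), Real.rpow_ofNat]
  have : ‖u z‖^α = (‖u z‖^2)^(α/2) := by
    rw [← Real.rpow_natCast, ← Real.rpow_mul (norm_nonneg _)]; congr 1; push_cast; ring
  rw [this]
  gcongr
  linarith

lemma grad_le {d n : ℕ} {u : Pt d n → ℂ} (h : InH2 d n u) {η : ℝ} (hη : 0 < η) :
    gradSq d n u ≤ η * lapSq d n u + 1/η * Mass d n u := by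
  have e : gradSq d n u = ∫ z, gd u z ∂(μP d n) := by
    unfold gradSq gradXSq gradYSq
    rw [← integral_add]
    · exact integral_congr_ae (Eventually.of_forall fun z => (gd_eq u z).symm)
    · exact integrable_finsetSum _ fun i _ => v1_int h (Sum.inl i)
    · exact integrable_finsetSum _ fun i _ => v1_int h (Sum.inr i)
  obtain ⟨-, i2, i3⟩ := weighted h (fun _ => 1) (fun _ => 0) 1 (fun t _ => hasDerivAt_const _ _)
    (fun _ _ => le_rfl) (fun _ _ => zero_le_one) (fun _ _ => le_rfl) (fun _ _ => by simp)
  simp only [one_mul] at i2 i3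
  rw [e]
  refine i3.trans ?_
  calc _ ≤ ∫ z, (η * ‖lap d n u z‖^2 + 1/η * ‖u z‖^2) ∂(μP d n) := by
        apply integral_mono i2 (((lap_int h).const_mul _).add (h.2.2.1.const_mul _))
        intro z
        simp only [Pi.add_apply]
        have h1 : η * ‖lap d n u z‖^2 + 1/η * ‖u z‖^2 - ‖u z‖ * ‖lap d n u z‖ =
          1/η * ((‖u z‖ - η/2 * ‖lap d n u z‖)^2 + 3/4 * (η * ‖lap d n u z‖)^2) := by field_simp; ring
        have h2 : 0 ≤ 1/η * ((‖u z‖ - η/2 * ‖lap d n u z‖)^2 + 3/4 * (η * ‖lap d n u z‖)^2) := by positivity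
        linarith
    _ = _ := by
        rw [integral_add ((lap_int h).const_mul _) (h.2.2.1.const_mul _), integral_const_mul, integral_const_mul]
        rfl

lemma En_bdd {d n : ℕ} (hd : 1 ≤ d) (hn : 1 ≤ n) {β α c : ℝ} (hα : 0 < α) (hα' : α < 8 / ((d:ℝ)+n))
    (hc : 0 < c) : BddBelow (En d n β α '' Sset d n c) := by
  obtain ⟨C, hC⟩ := npow_le hd hn hα hα' hc (η := 1/4) (by norm_num)
  refine ⟨-(|β|/2 * (2*(|β|+1) * c)) - 1/(α+2) * C, ?_⟩
  rintro _ ⟨u, hu, rfl⟩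
  have h1 := hC u hu
  have h2 := grad_le hu.1 (η := 1/(2*(|β|+1))) (by positivity)
  rw [hu.2, one_div_one_div] at h2
  have hL0 : 0 ≤ lapSq d n u := integral_nonneg fun z => by positivity
  have hG0 : 0 ≤ gradSq d n u := add_nonneg (integral_nonneg fun z => by positivity)
    (integral_nonneg fun z => by positivity)
  unfold En
  have b0 := abs_nonneg β
  have h3 : -(|β|/2 * gradSq d n u) ≤ β/2 * gradSq d n u := by nlinarith [neg_abs_le β]
  have h4 : |β|/2 * gradSq d n u ≤ |β|/2 * (1/(2*(|β|+1)) * lapSq d n u + 2*(|β|+1)*c) := by gcongr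
  have h5 : |β|/2 * (1/(2*(|β|+1))) ≤ 1/4 := by
    rw [div_mul_div_comm, div_le_div_iff₀ (by positivity) (by norm_num)]; linarith
  have h6 := mul_le_mul_of_nonneg_right h5 hL0
  have h7 : 1/(α+2) * Npow d n (α+2) u ≤ 1/(α+2) * (1/4 * lapSq d n u + C) := by gcongr
  have h8 : 1/(α+2) ≤ 1/2 := by
    rw [div_le_div_iff₀ (by positivity) (by norm_num)]; linarith
  have h9 := mul_le_mul_of_nonneg_right h8 hL0
  linarith

end BNLS

open BNLS in
/-- continuity of `c ↦ m_c` on `(0,∞)`. -/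
theorem stmt_5 (d n : ℕ) (hd : 1 ≤ d) (hn : 1 ≤ n) (β α : ℝ)
    (hα : 0 < α) (hα' : α < 8 / ((d:ℝ)+n)) :
    ContinuousOn (fun c => mC d n β α c) (Set.Ioi 0) :=
  (mC_concave hα fun _ hc => En_bdd hd hn hα hα' hc).continuousOn isOpen_Ioi
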